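/- Let μ be a regular cardinal. Let K be a category in which every morphism is a monomorphism, together with a faithful functor U : K → Set that preserves colimits of μ-directed diagrams. Assume K is μ-accessible: K has colimits of all μ-directed diagrams, and there is a set A of μ-presentable objects of K such that every object of K is the colimit of a μ-directed diagram with values in A. Then for every object M of K and every infinite subset X ⊆ U(M), there exist an object M₀ of K and a morphism m : M₀ → M such that X ⊆ range(U(m)) and M₀ is (|X|^{<μ})⁺-presentable. -/

import Mathlib

universe u v

open Cardinal CategoryTheory

/-- A preorder is `θ`-directed if every subset of cardinality `< θ` has an upper bound. -/
def IsMuDirected (θ : Cardinal.{u}) (J : Type u) [Preorder J] : Prop :=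
  ∀ s : Set J, #s < θ → ∃ ub : J, ∀ j ∈ s, j ≤ ub

/-- An object `M` of a category `C` is `θ`-presentable if its hom-functor
`Hom_C(M, −) : C → Set` preserves colimits of `θ`-directed diagrams. -/
def IsPresentable (θ : Cardinal.{u}) {C : Type v} [Category.{u} C] (M : C) : Prop :=
  ∀ (J : Type u) [Preorder J], IsMuDirected θ J →
    Nonempty (Limits.PreservesColimitsOfShape J (coyoneda.obj (Opposite.op M)))

theorem Cardinal.mk_Iio_ordToType_lt {c : Cardinal.{u}} (a : c.ord.ToType) :
    #(Set.Iio a) < c := by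
  simpa using mk_Iio_lt a

theorem Cardinal.exists_mk_Iio_eq {c γ : Cardinal.{u}} (h : γ < c) :
    ∃ a : c.ord.ToType, #(Set.Iio a) = γ := by
  refine ⟨Ordinal.ToType.mk ⟨γ.ord, ord_lt_ord.2 h⟩, ?_⟩
  exact (congrArg Ordinal.card (Ordinal.typein_enum _ _)).trans (card_ord γ)

theorem Cardinal.self_le_powerlt_of_aleph0_le {μ lam : Cardinal.{u}} (hlam : ℵ₀ ≤ lam) :
    μ ≤ lam ^< μ := by
  by_contra! h
  exact (cantor' (lam ^< μ) (one_lt_aleph0.trans_le hlam)).not_ge (le_powerlt lam h)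

theorem Cardinal.IsRegular.le_powerlt_self {μ : Cardinal.{u}} (hμ : μ.IsRegular)
    (lam : Cardinal.{u}) : lam ≤ lam ^< μ := by
  simpa using le_powerlt lam (one_lt_aleph0.trans_le hμ.aleph0_le)

/-- For `μ` regular and `lam` infinite, `lam ^< μ` is closed under powers below `μ`. -/
theorem Cardinal.IsRegular.powerlt_power_le {μ lam δ : Cardinal.{u}} (hμ : μ.IsRegular)
    (hlam : ℵ₀ ≤ lam) (hδ : δ < μ) : (lam ^< μ) ^ δ ≤ lam ^< μ := by
  set κ := lam ^< μ
  have hμκ : μ ≤ κ := self_le_powerlt_of_aleph0_le hlam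
  have hκ0 : ℵ₀ ≤ κ := hμ.aleph0_le.trans hμκ
  have bound (x : κ.ord.ToType) : ∃ γ < μ, #(Set.Iio x) < lam ^ γ := by
    have h := mk_Iio_ordToType_lt x
    by_contra! hx
    exact h.not_ge (powerlt_le.2 hx)
  choose g hgμ hg using bound
  let B (γ : Cardinal.{u}) : Set κ.ord.ToType := {x | #(Set.Iio x) < lam ^ γ}
  have hB (γ : Cardinal.{u}) : #(B γ) ≤ lam ^ γ := by
    by_contra! h
    obtain ⟨a, ha⟩ := exists_mk_Iio_eq (h.trans_le ((mk_set_le _).trans_eq (mk_ord_toType κ)))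
    refine h.not_ge (ha ▸ mk_le_mk_of_subset fun x hx => ?_)
    by_contra hxa
    have hx' : #(Set.Iio x) < #(Set.Iio a) := ha ▸ hx
    exact hx'.not_ge (mk_le_mk_of_subset (Set.Iio_subset_Iio (not_lt.1 hxa)))
  induction δ using Cardinal.inductionOn with | _ D
  let T (a : μ.ord.ToType) : Set (D → κ.ord.ToType) := {f | ∀ d, f d ∈ B #(Set.Iio a)}
  have hT (a : μ.ord.ToType) : #(T a) ≤ κ := by
    have e : T a ≃ (D → B #(Set.Iio a)) := Equiv.subtypePiEquivPi
    rw [mk_congr e, ← power_def]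
    refine (power_le_power_right (hB _)).trans ?_
    rw [← power_mul]
    exact le_powerlt lam (mul_lt_of_lt hμ.aleph0_le (mk_Iio_ordToType_lt a) hδ)
  have hcover : ⋃ a, T a = Set.univ := by
    refine Set.eq_univ_of_forall fun f => Set.mem_iUnion.2 ?_
    have hsup : ⨆ d, g (f d) < μ :=
      iSup_lt_of_lt_cof_ord (by rwa [hμ.cof_ord]) fun d => hgμ _
    obtain ⟨a, ha⟩ : ∃ a : μ.ord.ToType, #(Set.Iio a) = ⨆ d, g (f d) :=
      exists_mk_Iio_eq hsup
    refine ⟨a, fun d => (hg (f d)).trans_le ?_⟩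
    rw [ha]
    exact power_le_power_left (aleph0_pos.trans_le hlam).ne'
      (le_ciSup (f := fun d => g (f d)) bddAbove_of_small d)
  calc κ ^ #D = #(D → κ.ord.ToType) := by rw [← power_def, mk_ord_toType]
    _ = #(⋃ a, T a) := by rw [hcover, mk_univ]
    _ ≤ #μ.ord.ToType * ⨆ a, #(T a) := mk_iUnion_le T
    _ ≤ κ * κ := mul_le_mul' (by rwa [mk_ord_toType]) (ciSup_le' hT)
    _ = κ := mul_eq_self hκ0

/-- In a `μ`-directed preorder, a subset of cardinality at most `κ = κ ^< μ` lies in a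
`μ`-directed subset of cardinality at most `κ`. -/
theorem IsMuDirected.exists_subset {μ κ : Cardinal.{u}} (hκ0 : ℵ₀ ≤ κ)
    (hμκ : μ ≤ κ) (hpow : ∀ δ < μ, κ ^ δ ≤ κ) {J : Type u} [Preorder J]
    (hJ : IsMuDirected μ J) (S : Set J) (hS : #S ≤ κ) :
    ∃ I : Set J, S ⊆ I ∧ #I ≤ κ ∧ IsMuDirected μ I := by
  choose ub hub using hJ
  let β : S ⊕ μ.ord.ToType → Type u := Sum.elim (fun _ => PEmpty) (fun a => Set.Iio a)
  have hrange (a : μ.ord.ToType) (f : Set.Iio a → J) : #(Set.range f) < μ :=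
    mk_range_le.trans_lt (mk_Iio_ordToType_lt a)
  let step : (Σ a, β a → J) → J
    | ⟨.inl s, _⟩ => s
    | ⟨.inr a, f⟩ => ub (Set.range f) (hrange a f)
  let ev : WType β → J := WType.elim J step
  refine ⟨Set.range ev, fun s hs => ⟨⟨.inl ⟨s, hs⟩, PEmpty.elim⟩, rfl⟩, ?_, fun t ht => ?_⟩
  · refine mk_range_le.trans (WType.cardinalMk_le_of_le ?_)
    have h (a : S ⊕ μ.ord.ToType) : κ ^ #(β a) ≤ κ := by
      cases a with
      | inl s => simpa [β] using one_le_aleph0.trans hκ0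
      | inr a => exact hpow _ (mk_Iio_ordToType_lt a)
    calc sum (fun a => κ ^ #(β a)) ≤ #(S ⊕ μ.ord.ToType) * ⨆ a, κ ^ #(β a) :=
          sum_le_mk_mul_iSup _
      _ ≤ (κ + κ) * κ := mul_le_mul'
          (by simpa using add_le_add hS hμκ) (ciSup_le' h)
      _ = κ := by rw [add_eq_self hκ0, mul_eq_self hκ0]
  · obtain ⟨a, ⟨e⟩⟩ : ∃ a : μ.ord.ToType, Nonempty (Set.Iio a ≃ t) :=
      (exists_mk_Iio_eq ht).imp fun _ => Cardinal.eq.1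
    choose w hw using fun x : t => x.1.2
    refine ⟨⟨ev ⟨.inr a, fun i => w (e i)⟩, _, rfl⟩, fun j hj => ?_⟩
    refine hub _ (hrange a fun i => ev (w (e i))) _ ⟨e.symm ⟨j, hj⟩, ?_⟩
    simp [hw]

theorem IsMuDirected.mono {μ θ : Cardinal.{u}} (h : μ ≤ θ) {J : Type u} [Preorder J]
    (hJ : IsMuDirected θ J) : IsMuDirected μ J :=
  fun s hs => hJ s (hs.trans_le h)

theorem IsMuDirected.isCardinalFiltered {θ : Cardinal.{u}} [Fact θ.IsRegular] {J : Type u}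
    [Preorder J] (hJ : IsMuDirected θ J) : IsCardinalFiltered J θ :=
  isCardinalFiltered_preorder _ _ fun _ s hs =>
    (hJ (Set.range s) (mk_range_le.trans_lt hs)).imp fun _ h k => h _ ⟨k, rfl⟩

theorem IsPresentable.mono {μ θ : Cardinal.{u}} (h : μ ≤ θ) {C : Type v} [Category.{u} C]
    {M : C} (hM : IsPresentable μ M) : IsPresentable θ M :=
  fun J _ hJ => hM J (hJ.mono h)

theorem IsPresentable.of_iso {θ : Cardinal.{u}} {C : Type v} [Category.{u} C] {M N : C}
    (e : M ≅ N) (hM : IsPresentable θ M) : IsPresentable θ N := by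
  intro J _ hJ
  have := (hM J hJ).some
  exact ⟨Limits.preservesColimitsOfShape_of_natIso (coyoneda.mapIso e.symm.op)⟩

/-- A colimit of fewer than `θ` many `θ`-presentable objects is `θ`-presentable. -/
theorem IsPresentable.of_isColimit {θ : Cardinal.{u}} (hθ : θ.IsRegular) {C : Type v}
    [Category.{u} C] {I : Type u} [SmallCategory I] (hI : HasCardinalLT (Arrow I) θ)
    {F : I ⥤ C} (hF : ∀ i, IsPresentable θ (F.obj i)) {c : Limits.Cocone F}
    (hc : Limits.IsColimit c) : IsPresentable θ c.pt := by
  intro J _ hJ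
  have : Fact θ.IsRegular := ⟨hθ⟩
  have := hJ.isCardinalFiltered
  refine ⟨⟨fun {G} => ⟨fun {cG} hcG => ⟨?_⟩⟩⟩⟩
  refine Functor.Accessible.Limits.isColimitMapCocone (coyoneda.mapCone c.op)
    (fun Y => Limits.isLimitOfPreserves ((evaluation C (Type u)).obj Y)
      (Limits.isLimitOfPreserves _ hc.op)) θ (by simpa) cG fun i => ?_
  have := (hF i.unop J hJ).some
  exact Limits.isColimitOfPreserves (coyoneda.obj (Opposite.op (F.obj i.unop))) hcG

/-- **Statement 6.** Let `μ` be regular, `K` a category all of whose morphisms are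
monomorphisms, and `U : K ⥤ Set` a faithful functor preserving `μ`-directed colimits.
Assume `K` is `μ`-accessible: it has colimits of `μ`-directed diagrams and there is a
set (indexed family) `A` of `μ`-presentable objects such that every object of `K` is the
colimit of a `μ`-directed diagram with values in `A`. Then for every `M` in `K` and
every infinite `X ⊆ U(M)`, there are an object `M₀` and a morphism `m : M₀ ⟶ M` such
that `X ⊆ range (U(m))` and `M₀` is `(|X|^{<μ})⁺`-presentable. -/
theorem statement6 {K : Type v} [Category.{u} K] (μ : Cardinal.{u}) (hμ : μ.IsRegular)
    (hmono : ∀ {X Y : K} (f : X ⟶ Y), Mono f)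
    (U : K ⥤ Type u) (hfaithful : U.Faithful)
    (hUpres : ∀ (J : Type u) [Preorder J], IsMuDirected μ J →
      Nonempty (Limits.PreservesColimitsOfShape J U))
    (hcolim : ∀ (J : Type u) [Preorder J], IsMuDirected μ J →
      Limits.HasColimitsOfShape J K)
    (ι : Type u) (A : ι → K) (hA : ∀ i, IsPresentable μ (A i))
    (hacc : ∀ M : K, ∃ (J : Type u) (pre : Preorder J),
      letI := pre
      IsMuDirected μ J ∧ ∃ F : J ⥤ K, (∀ j : J, ∃ i : ι, Nonempty (F.obj j ≅ A i)) ∧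
        ∃ c : Limits.Cocone F, c.pt = M ∧ Nonempty (Limits.IsColimit c))
    (M : K) (X : Set (U.obj M)) (hX : X.Infinite) :
    ∃ (M₀ : K) (m : M₀ ⟶ M), X ⊆ Set.range (U.map m) ∧
      IsPresentable (Order.succ (#X ^< μ)) M₀ := by
  have hX0 : ℵ₀ ≤ #X := by
    have := hX.to_subtype
    exact aleph0_le_mk X
  set κ := #X ^< μ
  have hμκ : μ ≤ κ := self_le_powerlt_of_aleph0_le hX0
  have hκ0 : ℵ₀ ≤ κ := hμ.aleph0_le.trans hμκ
  obtain ⟨J, _, hJ, F, hFA, c, rfl, ⟨hc⟩⟩ := hacc M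
  have := (hUpres J hJ).some
  have hsurj (x : X) : ∃ (j : J) (y : U.obj (F.obj j)), U.map (c.ι.app j) y = x.1 :=
    Limits.Types.jointly_surjective_of_isColimit (Limits.isColimitOfPreserves U hc) x.1
  choose j y hy using hsurj
  obtain ⟨I, hSI, hIκ, hI⟩ := hJ.exists_subset hκ0 hμκ
    (fun δ hδ => hμ.powerlt_power_le hX0 hδ) (Set.range j)
    (mk_range_le.trans (hμ.le_powerlt_self _))
  have := hcolim I hI
  let G : I ⥤ J := Monotone.functor (f := ((↑) : I → J)) fun _ _ h => h
  refine ⟨Limits.colimit (G ⋙ F), Limits.colimit.desc (G ⋙ F) (c.whisker G), fun x hx => ?_, ?_⟩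
  · let i : I := ⟨j ⟨x, hx⟩, hSI ⟨_, rfl⟩⟩
    refine ⟨U.map (Limits.colimit.ι (G ⋙ F) i) (y ⟨x, hx⟩), ?_⟩
    have h := congrArg U.map (Limits.colimit.ι_desc (c.whisker G) i)
    rw [U.map_comp] at h
    exact (ConcreteCategory.congr_hom h (y ⟨x, hx⟩)).trans (hy ⟨x, hx⟩)
  · refine IsPresentable.of_isColimit (isRegular_succ hκ0) ?_ (fun i => ?_)
      (Limits.colimit.isColimit (G ⋙ F))
    · rw [hasCardinalLT_iff_cardinal_mk_lt, Order.lt_succ_iff]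
      have hinj : Function.Injective fun f : Arrow I => (f.left, f.right) := by
        rintro ⟨a, b, f⟩ ⟨a', b', f'⟩ h
        obtain ⟨rfl, rfl⟩ := Prod.mk.inj h
        rw [Subsingleton.elim f f']
      calc #(Arrow I) ≤ #(I × I) := mk_le_of_injective hinj
        _ ≤ κ * κ := by simpa using mul_le_mul' hIκ hIκ
        _ = κ := mul_eq_self hκ0
    · obtain ⟨k, ⟨e⟩⟩ := hFA i
      exact ((hA k).of_iso e.symm).mono (hμκ.trans (Order.le_succ κ))
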